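/- Let p(n) = ∑_{i=0}^k a_i n^i be a polynomial with real coefficients such that at least one of the coefficients a_1, …, a_k of the non-constant terms is irrational, and let d be any real number. Then the topological closure of the set {frac(p(n) + 2^n·d) : n ≥ 1} ⊆ [0,1] has Hausdorff dimension equal to 1. -/

import Mathlib

open MeasureTheory

/-- A mean-square bound from bounds on the off-diagonal correlations. -/
lemma sum_norm_sq_le_of_correlation (L H : ℕ) (z : ℕ → ℕ → ℂ) (B : ℝ) (hB0 : 0 ≤ B)
    (hz : ∀ i h, ‖z i h‖ ≤ 1)
    (hB : ∀ h < H, ∀ h' < H, h ≠ h' →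
      ‖∑ i ∈ Finset.range L, z i h * (starRingEnd ℂ) (z i h')‖ ≤ B) :
    ∑ i ∈ Finset.range L, ‖∑ h ∈ Finset.range H, z i h‖ ^ 2 ≤ H * L + H ^ 2 * B := by
  have h1 : ((∑ i ∈ Finset.range L, ‖∑ h ∈ Finset.range H, z i h‖ ^ 2 : ℝ) : ℂ)
      = ∑ h ∈ Finset.range H, ∑ h' ∈ Finset.range H,
        ∑ i ∈ Finset.range L, z i h * (starRingEnd ℂ) (z i h') := by
    push_cast
    have : ∀ i, (‖∑ h ∈ Finset.range H, z i h‖ : ℂ) ^ 2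
        = ∑ h ∈ Finset.range H, ∑ h' ∈ Finset.range H, z i h * (starRingEnd ℂ) (z i h') := by
      intro i
      rw [← Complex.mul_conj', map_sum, Finset.sum_mul_sum]
    simp_rw [this]
    rw [Finset.sum_comm]
    refine Finset.sum_congr rfl fun h _ => ?_
    rw [Finset.sum_comm]
  have h2 : ∑ i ∈ Finset.range L, ‖∑ h ∈ Finset.range H, z i h‖ ^ 2
      = ‖((∑ i ∈ Finset.range L, ‖∑ h ∈ Finset.range H, z i h‖ ^ 2 : ℝ) : ℂ)‖ := by
    rw [Complex.norm_real, Real.norm_of_nonneg (Finset.sum_nonneg fun i _ => by positivity)]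
  rw [h2, h1]
  calc _ ≤ ∑ h ∈ Finset.range H, ∑ h' ∈ Finset.range H, ((if h = h' then (L : ℝ) else 0) + B) := by
        refine norm_sum_le_of_le _ fun h hh => norm_sum_le_of_le _ fun h' hh' => ?_
        split_ifs with heq
        · subst heq
          calc _ ≤ ∑ i ∈ Finset.range L, (1 : ℝ) := by
                refine norm_sum_le_of_le _ fun i _ => ?_
                rw [norm_mul, RCLike.norm_conj]
                have := hz i h
                nlinarith [norm_nonneg (z i h)]
            _ ≤ _ := by simp [hB0]
        · simpa using hB h (Finset.mem_range.1 hh) h' (Finset.mem_range.1 hh') heq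
    _ = _ := by
        simp only [Finset.sum_add_distrib, Finset.sum_ite_eq, Finset.sum_const, Finset.card_range,
          nsmul_eq_mul]
        rw [Finset.sum_congr rfl (g := fun _ => (L : ℝ)) (fun h hh => if_pos hh)]
        rw [Finset.sum_const, Finset.card_range, nsmul_eq_mul]; ring

lemma norm_sum_shift_sub_le (a : ℕ → ℂ) (ha : ∀ i, ‖a i‖ ≤ 1) (L h : ℕ) :
    ‖∑ i ∈ Finset.range L, a (i + h) - ∑ i ∈ Finset.range L, a i‖ ≤ 2 * h := by
  induction h with
  | zero => simp
  | succ h ih =>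
    have h1 : ∑ i ∈ Finset.range L, a (i + (h + 1))
        = ∑ i ∈ Finset.range L, a (i + h) + (a (L + h) - a h) := by
      have := Finset.sum_range_succ (fun i => a (i + h)) L
      rw [Finset.sum_range_succ'] at this
      simp only [zero_add] at this
      have e : ∀ i, i + (h + 1) = i + 1 + h := by intro i; ring
      simp_rw [e]
      linear_combination this
    rw [h1]
    calc _ = ‖(∑ i ∈ Finset.range L, a (i + h) - ∑ i ∈ Finset.range L, a i)
            + (a (L + h) - a h)‖ := by congr 1; ring
      _ ≤ 2 * h + (1 + 1) := by
        refine (norm_add_le _ _).trans (add_le_add ih ((norm_sub_le _ _).trans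
          (add_le_add (ha _) (ha _))))
      _ = _ := by push_cast; ring

/-- Van der Corput's inequality. -/
lemma norm_sum_le_of_correlation (a : ℕ → ℂ) (ha : ∀ i, ‖a i‖ ≤ 1) (L H : ℕ) (B : ℝ)
    (hB0 : 0 ≤ B)
    (hB : ∀ h < H, ∀ h' < H, h ≠ h' →
      ‖∑ i ∈ Finset.range L, a (i + h) * (starRingEnd ℂ) (a (i + h'))‖ ≤ B) :
    H * ‖∑ i ∈ Finset.range L, a i‖ ≤ √(L * (H * L + H ^ 2 * B)) + 2 * H ^ 2 := by
  have h1 : ‖(H : ℂ) * ∑ i ∈ Finset.range L, a i‖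
      ≤ ‖∑ h ∈ Finset.range H, ∑ i ∈ Finset.range L, a (i + h)‖ + 2 * H ^ 2 := by
    have : ‖∑ h ∈ Finset.range H, (∑ i ∈ Finset.range L, a (i + h) - ∑ i ∈ Finset.range L, a i)‖
        ≤ ∑ h ∈ Finset.range H, (2 * H : ℝ) := by
      refine norm_sum_le_of_le _ fun h hh => (norm_sum_shift_sub_le a ha L h).trans ?_
      have : (h : ℝ) ≤ H := by exact_mod_cast (Finset.mem_range.1 hh).le
      linarith
    rw [Finset.sum_sub_distrib] at this
    simp only [Finset.sum_const, Finset.card_range, nsmul_eq_mul] at this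
    have h3 := norm_sub_norm_le ((H : ℂ) * ∑ i ∈ Finset.range L, a i)
      (∑ h ∈ Finset.range H, ∑ i ∈ Finset.range L, a (i + h))
    rw [norm_sub_rev] at this
    nlinarith
  rw [norm_mul, Complex.norm_natCast] at h1
  refine h1.trans ?_
  gcongr
  rw [Finset.sum_comm]
  refine (norm_sum_le _ _).trans (Real.le_sqrt_of_sq_le ?_)
  refine (sq_sum_le_card_mul_sum_sq).trans ?_
  rw [Finset.card_range]
  gcongr
  exact sum_norm_sq_le_of_correlation L H (fun i h => a (i + h)) B hB0 (fun i h => ha _) hB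

lemma fourierChar_mul_conj (x y : ℝ) :
    (Real.fourierChar x : ℂ) * (starRingEnd ℂ) (Real.fourierChar y : ℂ)
      = (Real.fourierChar (x - y) : ℂ) := by
  rw [← Circle.coe_inv_eq_conj, ← AddChar.map_neg_eq_inv, ← Circle.coe_mul,
    ← AddChar.map_add_eq_mul, sub_eq_add_neg]

lemma fourierChar_eq_one_iff {x : ℝ} (h : (Real.fourierChar x : ℂ) = 1) : ∃ n : ℤ, x = n := by
  rw [Real.fourierChar_apply, Complex.exp_eq_one_iff] at h
  obtain ⟨n, hn⟩ := h
  refine ⟨n, ?_⟩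
  have h2 : (2 * Real.pi * Complex.I : ℂ) ≠ 0 := by simp [Real.pi_ne_zero]
  have : (x : ℂ) = n := by
    apply mul_left_cancel₀ h2
    rw [mul_comm _ (n : ℂ), ← hn]; push_cast; ring
  exact_mod_cast this

lemma Polynomial.coeff_taylor_of_natDegree_le {R : Type*} [CommSemiring R] {p : Polynomial R}
    {m : ℕ} (hp : p.natDegree ≤ m) (r : R) : (taylor r p).coeff m = p.coeff m := by
  have hd : (hasseDeriv m p).natDegree = 0 := by
    have := natDegree_hasseDeriv_le p m; omega
  rw [taylor_coeff, eq_C_of_natDegree_eq_zero hd]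
  simp [hasseDeriv_coeff]

open Polynomial in
/-- Weyl's estimate, uniform in all non-leading coefficients. -/
theorem norm_weyl_sum_le (k : ℕ) : ∀ α : ℝ, Irrational α → ∀ δ : ℝ, 0 < δ → ∃ L₀ : ℕ, ∀ L ≥ L₀,
    ∀ p : ℝ[X], p.natDegree ≤ k + 1 → p.coeff (k + 1) = α →
      ‖∑ i ∈ Finset.range L, (Real.fourierChar (p.eval (i : ℝ)) : ℂ)‖ ≤ δ * L := by
  induction k with
  | zero =>
    intro α hα δ hδ
    set r : ℂ := (Real.fourierChar α : ℂ) with hr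
    have hr1 : r ≠ 1 := by
      intro h
      obtain ⟨n, hn⟩ := fourierChar_eq_one_iff h
      exact hα ⟨n, by simp [hn]⟩
    have hr0 : 0 < ‖r - 1‖ := norm_pos_iff.2 (sub_ne_zero.2 hr1)
    obtain ⟨L₀, hL₀⟩ := exists_nat_ge (2 / ‖r - 1‖ / δ)
    refine ⟨L₀, fun L hL p hp hpα => ?_⟩
    have hp' : ∀ i : ℕ, (Real.fourierChar (p.eval (i : ℝ)) : ℂ)
        = (Real.fourierChar (p.coeff 0) : ℂ) * r ^ i := by
      intro i
      rw [Polynomial.eval_eq_sum_range' (n := 2) (by omega)]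
      simp only [Finset.sum_range_succ, Finset.sum_range_zero, zero_add, pow_zero, mul_one, pow_one]
      simp only [zero_add] at hpα
      rw [AddChar.map_add_eq_mul, Circle.coe_mul, hpα, hr, ← Circle.coe_pow,
        ← AddChar.map_nsmul_eq_pow, nsmul_eq_mul, mul_comm α]
    simp_rw [hp']
    rw [← Finset.mul_sum, geom_sum_eq hr1, norm_mul, Circle.norm_coe, one_mul, norm_div]
    have h1 : ‖r ^ L - 1‖ ≤ 2 := by
      refine (norm_sub_le _ _).trans ?_
      rw [norm_pow, hr, Circle.norm_coe]; norm_num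
    calc _ ≤ 2 / ‖r - 1‖ := by gcongr
      _ ≤ δ * L₀ := by rwa [div_le_iff₀' hδ] at hL₀
      _ ≤ δ * L := by gcongr
  | succ k ih =>
    intro α hα δ hδ
    obtain ⟨H, hH⟩ := exists_nat_ge (8 / δ ^ 2)
    have hHpos : (0 : ℝ) < H := lt_of_lt_of_le (by positivity) hH
    have key : ∀ q : ℕ × ℕ, ∃ L₀ : ℕ, q.1 ≠ q.2 → ∀ L ≥ L₀,
        ∀ p : ℝ[X], p.natDegree ≤ k + 1 →
          p.coeff (k + 1) = α * ((k + 2 : ℕ) * ((q.1 : ℤ) - q.2 : ℤ) : ℤ) →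
        ‖∑ i ∈ Finset.range L, (Real.fourierChar (p.eval (i : ℝ)) : ℂ)‖ ≤ (δ ^ 2 / 8) * L := by
      intro q
      by_cases hq : q.1 = q.2
      · exact ⟨0, fun h => absurd hq h⟩
      · obtain ⟨L₀, h⟩ := ih (α * ((k + 2 : ℕ) * ((q.1 : ℤ) - q.2 : ℤ) : ℤ))
          (hα.mul_intCast (mul_ne_zero (by positivity) (by omega))) (δ ^ 2 / 8) (by positivity)
        exact ⟨L₀, fun _ => h⟩
    choose L₁ hL₁ using key
    obtain ⟨L₂, hL₂⟩ := exists_nat_ge (4 * H / δ)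
    refine ⟨max L₂ ((Finset.range H ×ˢ Finset.range H).sup L₁), fun L hL p hp hpα => ?_⟩
    have hvc := norm_sum_le_of_correlation (fun i => (Real.fourierChar (p.eval (i : ℝ)) : ℂ))
      (fun i => (Circle.norm_coe _).le) L H (δ ^ 2 / 8 * L) (by positivity) (by
        intro h hh h' hh' hne
        rw [Finset.sum_congr rfl fun i _ => fourierChar_mul_conj _ _]
        have := hL₁ (h, h') hne L (le_trans (Finset.le_sup (f := L₁) (b := (h, h'))
          (by simp [hh, hh'])) ((le_max_right _ _).trans hL))
          (taylor (h : ℝ) p - taylor (h' : ℝ) p) ?_ ?_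
        · simpa [taylor_eval] using this
        · rw [natDegree_le_iff_coeff_eq_zero]
          intro N hN
          have hN' : p.natDegree ≤ N := by omega
          rw [coeff_sub, coeff_taylor_of_natDegree_le hN', coeff_taylor_of_natDegree_le hN',
            sub_self]
        · rw [coeff_sub, taylor_coeff, taylor_coeff]
          have hd : (hasseDeriv (k + 1) p).natDegree ≤ 1 := by
            have := natDegree_hasseDeriv_le p (k + 1); omega
          rw [eval_eq_sum_range' (n := 2) (by omega), eval_eq_sum_range' (n := 2) (by omega)]
          simp only [Finset.sum_range_succ, Finset.sum_range_zero, hasseDeriv_coeff]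
          have : 1 + (k + 1) = k + 1 + 1 := by ring
          rw [this, hpα, Nat.choose_succ_self_right]
          push_cast; ring)
    have hL2 : (L₂ : ℝ) ≤ L := by exact_mod_cast (le_max_left _ _).trans hL
    have hL0 : (0 : ℝ) ≤ L := by positivity
    have hsq : √(L * (H * L + H ^ 2 * (δ ^ 2 / 8 * L))) ≤ H * (δ / 2 * L) := by
      apply Real.sqrt_le_iff.2 ⟨by positivity, ?_⟩
      have : (8 : ℝ) ≤ H * δ ^ 2 := by rwa [div_le_iff₀ (by positivity)] at hH
      have h3 : (H : ℝ) * L ^ 2 * 8 ≤ (H : ℝ) * L ^ 2 * (H * δ ^ 2) := by gcongr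
      nlinarith
    have h4 : (4 : ℝ) * H ≤ δ * L := by
      rw [div_le_iff₀ hδ] at hL₂; nlinarith
    have : (H : ℝ) * ‖∑ i ∈ Finset.range L, (Real.fourierChar (p.eval (i : ℝ)) : ℂ)‖
        ≤ H * (δ * L) := by
      nlinarith
    exact le_of_mul_le_mul_left this hHpos

lemma half_le_norm_sum_fourierChar (N : ℕ) (hN : 0 < N) (x : ℝ) (z : ℤ)
    (hx : |x - z| ≤ 1 / (8 * N)) :
    (N : ℝ) ^ 2 / 4 ≤ ‖∑ j ∈ Finset.range N, (Real.fourierChar (j * x) : ℂ)‖ ^ 2 := by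
  have hN' : (0 : ℝ) < N := by exact_mod_cast hN
  have h1 : ∀ j ∈ Finset.range N, (1 / 2 : ℝ) ≤ (Real.fourierChar (j * x) : ℂ).re := by
    intro j hj
    rw [Real.fourierChar_apply, Complex.exp_ofReal_mul_I_re]
    have e : 2 * Real.pi * (j * x) = 2 * Real.pi * (j * (x - z))
        + ((j * z : ℤ) : ℝ) * (2 * Real.pi) := by
      push_cast; ring
    rw [e, Real.cos_add_int_mul_two_pi, ← Real.cos_abs, ← Real.cos_pi_div_three]
    have hjN : (j : ℝ) ≤ N := by exact_mod_cast (Finset.mem_range.1 hj).le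
    have : |2 * Real.pi * (j * (x - z))| ≤ Real.pi / 4 := by
      rw [abs_mul, abs_mul (j : ℝ), abs_of_pos Real.two_pi_pos, Nat.abs_cast]
      calc _ ≤ 2 * Real.pi * (N * (1 / (8 * N))) := by gcongr
        _ = _ := by field_simp; norm_num
    apply Real.cos_le_cos_of_nonneg_of_le_pi (abs_nonneg _)
    · linarith [Real.pi_pos]
    · linarith [Real.pi_pos]
  have h2 : (N : ℝ) / 2 ≤ (∑ j ∈ Finset.range N, (Real.fourierChar (j * x) : ℂ)).re := by
    rw [Complex.re_sum]
    calc (N : ℝ) / 2 = ∑ j ∈ Finset.range N, (1 / 2 : ℝ) := by simp; ring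
      _ ≤ _ := Finset.sum_le_sum h1
  have h3 := h2.trans (Complex.re_le_norm _)
  calc (N : ℝ) ^ 2 / 4 = (N / 2) ^ 2 := by ring
    _ ≤ _ := by gcongr

open Polynomial Classical in
/-- Polynomials with irrational leading coefficient visit an arc not much more often than its
length dictates, uniformly in the non-leading coefficients. -/
theorem card_visits_le (k : ℕ) (α : ℝ) (hα : Irrational α) (M : ℕ) (hM : 0 < M) :
    ∃ L₀ : ℕ, ∀ L ≥ L₀, ∀ p : ℝ[X], p.natDegree ≤ k + 1 → p.coeff (k + 1) = α → ∀ c : ℝ,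
      (((Finset.range L).filter fun i : ℕ => ∃ z : ℤ, |p.eval (i : ℝ) - c - z| ≤ 3 / M).card : ℝ)
        ≤ 384 * L / M := by
  rcases lt_or_ge M 24 with hM24 | hM24
  · refine ⟨0, fun L _ p _ _ c => ?_⟩
    have h1 : (((Finset.range L).filter fun i : ℕ =>
        ∃ z : ℤ, |p.eval (i : ℝ) - c - z| ≤ 3 / M).card : ℝ) ≤ L := by
      exact_mod_cast (Finset.card_filter_le _ _).trans (by simp)
    have h2 : (M : ℝ) ≤ 24 := by exact_mod_cast hM24.le
    have hM' : (0 : ℝ) < M := by exact_mod_cast hM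
    rw [le_div_iff₀ hM']
    have : (0 : ℝ) ≤ L := by positivity
    nlinarith
  set N := M / 24 with hN
  have hN1 : 0 < N := by omega
  have hN' : (0 : ℝ) < N := by exact_mod_cast hN1
  have hM' : (0 : ℝ) < M := by exact_mod_cast hM
  have hNM : (M : ℝ) ≤ 48 * N := by exact_mod_cast (by omega : M ≤ 48 * N)
  have hNM2 : 24 * (N : ℝ) ≤ M := by exact_mod_cast (by omega : 24 * N ≤ M)
  have key : ∀ q : ℕ × ℕ, ∃ L₀ : ℕ, q.1 ≠ q.2 → ∀ L ≥ L₀,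
      ∀ p : ℝ[X], p.natDegree ≤ k + 1 → p.coeff (k + 1) = α * ((q.1 : ℤ) - q.2 : ℤ) →
        ‖∑ i ∈ Finset.range L, (Real.fourierChar (p.eval (i : ℝ)) : ℂ)‖ ≤ (1 / N) * L := by
    intro q
    by_cases hq : q.1 = q.2
    · exact ⟨0, fun h => absurd hq h⟩
    · obtain ⟨L₀, h⟩ := norm_weyl_sum_le k (α * ((q.1 : ℤ) - q.2 : ℤ))
          (hα.mul_intCast (by omega)) (1 / N) (by positivity)
      exact ⟨L₀, fun _ => h⟩
  choose L₁ hL₁ using key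
  refine ⟨(Finset.range N ×ˢ Finset.range N).sup L₁, fun L hL p hp hpα c => ?_⟩
  have hms := sum_norm_sq_le_of_correlation L N
    (fun i h => (Real.fourierChar (h * (p.eval (i : ℝ) - c)) : ℂ)) (1 / N * L) (by positivity)
    (fun i h => (Circle.norm_coe _).le) (by
      intro h hh h' hh' hne
      rw [Finset.sum_congr rfl fun i _ => fourierChar_mul_conj _ _]
      have := hL₁ (h, h') hne L (le_trans (Finset.le_sup (f := L₁) (b := (h, h'))
          (by simp [hh, hh'])) hL)
          (C ((h : ℝ) - h') * (p - C c)) ?_ ?_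
      · simpa [sub_mul] using this
      · refine (natDegree_C_mul_le _ _).trans ((natDegree_sub_le _ _).trans ?_)
        simp [hp]
      · rw [coeff_C_mul, coeff_sub, coeff_C_succ, hpα]; push_cast; ring)
  have hcount : (((Finset.range L).filter fun i : ℕ =>
      ∃ z : ℤ, |p.eval (i : ℝ) - c - z| ≤ 3 / M).card : ℝ) * ((N : ℝ) ^ 2 / 4) ≤
      ∑ i ∈ Finset.range L,
        ‖∑ h ∈ Finset.range N, (Real.fourierChar (h * (p.eval (i : ℝ) - c)) : ℂ)‖ ^ 2 := by
    rw [← nsmul_eq_mul]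
    refine (Finset.card_nsmul_le_sum _ _ _ ?_).trans
      (Finset.sum_le_sum_of_subset_of_nonneg (Finset.filter_subset _ _)
        fun _ _ _ => by positivity)
    intro i hi
    obtain ⟨z, hz⟩ := (Finset.mem_filter.1 hi).2
    refine half_le_norm_sum_fourierChar N hN1 _ z (hz.trans ?_)
    rw [div_le_div_iff₀ hM' (by positivity)]
    linarith
  have h5 := hcount.trans hms
  have h6 : (N : ℝ) ^ 2 * (1 / N * L) = N * L := by field_simp
  rw [h6] at h5
  have h7 : (((Finset.range L).filter fun i : ℕ =>
      ∃ z : ℤ, |p.eval (i : ℝ) - c - z| ≤ 3 / M).card : ℝ) * N ≤ 8 * L := by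
    refine le_of_mul_le_mul_left ?_ hN'
    nlinarith
  rw [le_div_iff₀ hM']
  refine (mul_le_mul_of_nonneg_left hNM (by positivity)).trans ?_
  nlinarith

/-- The integer whose base-`b` expansion is the block of digits of `D` at the `m` places after the
first `n` fractional ones. -/
noncomputable def digitBlock (b : ℕ) (D : ℝ) (n m : ℕ) : ℤ :=
  ⌊(b : ℝ) ^ (n + m) * D⌋ - (b : ℤ) ^ m * ⌊(b : ℝ) ^ n * D⌋

lemma digitBlock_add (b : ℕ) (D : ℝ) (n m m' : ℕ) :
    digitBlock b D n (m + m')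
      = (b : ℤ) ^ m' * digitBlock b D n m + digitBlock b D (n + m) m' := by
  unfold digitBlock
  rw [← add_assoc]; ring

lemma digitBlock_nonneg (b : ℕ) (D : ℝ) (n m : ℕ) : 0 ≤ digitBlock b D n m := by
  unfold digitBlock
  refine sub_nonneg.2 (Int.le_floor.2 ?_)
  push_cast
  rw [show (b : ℝ) ^ (n + m) * D = (b : ℝ) ^ m * ((b : ℝ) ^ n * D) by ring]
  gcongr
  exact Int.floor_le ((b : ℝ) ^ n * D)

lemma digitBlock_lt (b : ℕ) (hb : 2 ≤ b) (D : ℝ) (n m : ℕ) : digitBlock b D n m < (b : ℤ) ^ m := by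
  unfold digitBlock
  have : (0 : ℝ) < (b : ℝ) ^ m := by positivity
  refine sub_lt_iff_lt_add.2 (Int.floor_lt.2 ?_)
  push_cast
  rw [pow_add, mul_comm ((b : ℝ) ^ n), mul_assoc]
  have := Int.lt_floor_add_one ((b : ℝ) ^ n * D)
  nlinarith

lemma digitBlock_approx (b : ℕ) (hb : 2 ≤ b) (D : ℝ) (n m : ℕ) :
    |(b : ℝ) ^ n * D - ⌊(b : ℝ) ^ n * D⌋ - digitBlock b D n m / (b : ℝ) ^ m| ≤ 1 / (b : ℝ) ^ m := by
  have h0 : (0 : ℝ) < (b : ℝ) ^ m := by positivity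
  have h1 : (b : ℝ) ^ n * D - ⌊(b : ℝ) ^ n * D⌋ - digitBlock b D n m / (b : ℝ) ^ m
      = ((b : ℝ) ^ (n + m) * D - ⌊(b : ℝ) ^ (n + m) * D⌋) / (b : ℝ) ^ m := by
    unfold digitBlock
    push_cast
    field_simp
    ring
  rw [h1, abs_div, abs_of_pos h0]
  gcongr
  rw [abs_le]
  constructor <;> linarith [Int.floor_le ((b : ℝ) ^ (n + m) * D),
    Int.lt_floor_add_one ((b : ℝ) ^ (n + m) * D)]

lemma exists_digitBlock_eq (b : ℕ) (hb : 2 ≤ b) (D : ℝ) (r m : ℕ) :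
    ∃ φ : ℤ × ℤ → ℤ, ∀ n, digitBlock b D n r
      = φ (digitBlock b D n m, digitBlock b D (n + m) (r - m)) := by
  rcases le_total m r with h | h
  · refine ⟨fun q => (b : ℤ) ^ (r - m) * q.1 + q.2, fun n => ?_⟩
    have := digitBlock_add b D n m (r - m)
    rwa [Nat.add_sub_cancel' h] at this
  · refine ⟨fun q => q.1 / (b : ℤ) ^ (m - r), fun n => ?_⟩
    have h0 : (0 : ℤ) < (b : ℤ) ^ (m - r) := by positivity
    have := digitBlock_add b D n r (m - r)
    rw [Nat.add_sub_cancel' h] at this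
    simp only
    rw [this, Int.mul_add_ediv_left _ _ h0.ne',
      Int.ediv_eq_zero_of_lt (digitBlock_nonneg _ _ _ _) (digitBlock_lt b hb _ _ _), add_zero]

lemma finite_digitBlock (b : ℕ) (hb : 2 ≤ b) (D : ℝ) (m : ℕ) :
    (Set.range fun n => digitBlock b D n m).Finite :=
  (Set.finite_Ico 0 ((b : ℤ) ^ m)).subset (by
    rintro _ ⟨n, rfl⟩
    exact ⟨digitBlock_nonneg _ _ _ _, digitBlock_lt b hb _ _ _⟩)

/-- The number of digit blocks of length `m`. -/
noncomputable def blockCount (b : ℕ) (D : ℝ) (m : ℕ) : ℕ :=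
  (Set.range fun n => digitBlock b D n m).ncard

lemma blockCount_pos (b : ℕ) (hb : 2 ≤ b) (D : ℝ) (m : ℕ) : 0 < blockCount b D m :=
  (Set.ncard_pos (finite_digitBlock b hb D m)).2 (Set.range_nonempty _)

lemma blockCount_le (b : ℕ) (hb : 2 ≤ b) (D : ℝ) (m : ℕ) : blockCount b D m ≤ b ^ m := by
  calc _ ≤ (Set.Ico (0 : ℤ) ((b : ℤ) ^ m)).ncard := by
        refine Set.ncard_le_ncard ?_ (Set.finite_Ico _ _)
        rintro _ ⟨n, rfl⟩
        exact ⟨digitBlock_nonneg _ _ _ _, digitBlock_lt b hb _ _ _⟩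
    _ = _ := by
      rw [← Finset.coe_Ico, Set.ncard_coe_finset, Int.card_Ico, sub_zero]
      exact_mod_cast Int.toNat_natCast (b ^ m)

lemma blockCount_add_le (b : ℕ) (hb : 2 ≤ b) (D : ℝ) (m m' : ℕ) :
    blockCount b D (m + m') ≤ blockCount b D m * blockCount b D m' := by
  unfold blockCount
  rw [← Set.ncard_prod]
  have hfin := (finite_digitBlock b hb D m).prod (finite_digitBlock b hb D m')
  refine le_trans (Set.ncard_le_ncard ?_ (hfin.image fun q => (b : ℤ) ^ m' * q.1 + q.2))
    (Set.ncard_image_le hfin)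
  rintro _ ⟨n, rfl⟩
  exact ⟨(digitBlock b D n m, digitBlock b D (n + m) m'), ⟨⟨n, rfl⟩, ⟨n + m, rfl⟩⟩,
    (digitBlock_add b D n m m').symm⟩

/-- The number of digit blocks has an exponential growth rate. -/
lemma exists_blockCount_rate (b : ℕ) (hb : 2 ≤ b) (D : ℝ) (κ : ℝ) (hκ : 0 < κ) :
    ∃ h : ℝ, 0 ≤ h ∧ (∀ m : ℕ, (b : ℝ) ^ (h * m) ≤ blockCount b D m) ∧
      ∃ C : ℝ, 0 < C ∧ ∀ m : ℕ, (blockCount b D m : ℝ) ≤ C * (b : ℝ) ^ ((h + κ) * m) := by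
  have hb1 : (1 : ℝ) < b := by exact_mod_cast hb
  have hb0 : (0 : ℝ) < b := by linarith
  have hW : ∀ m, (0 : ℝ) < blockCount b D m := fun m => by exact_mod_cast blockCount_pos b hb D m
  have hW1 : ∀ m, (1 : ℝ) ≤ blockCount b D m := fun m => by exact_mod_cast blockCount_pos b hb D m
  have hsub : Subadditive fun m => Real.logb b (blockCount b D m) := by
    intro m n
    rw [← Real.logb_mul (hW m).ne' (hW n).ne']
    exact Real.logb_le_logb_of_le hb1 (hW _) (by exact_mod_cast blockCount_add_le b hb D m n)
  have hnn : ∀ m : ℕ, 0 ≤ Real.logb b (blockCount b D m) / m := fun m =>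
    div_nonneg (Real.logb_nonneg hb1 (hW1 m)) (Nat.cast_nonneg m)
  have hbdd : BddBelow (Set.range fun m : ℕ => Real.logb b (blockCount b D m) / m) :=
    ⟨0, by rintro _ ⟨m, rfl⟩; exact hnn m⟩
  have hlim := hsub.tendsto_lim hbdd
  have hh0 : 0 ≤ hsub.lim := ge_of_tendsto' hlim hnn
  refine ⟨hsub.lim, hh0, fun m => ?_, ?_⟩
  · rcases Nat.eq_zero_or_pos m with rfl | hm
    · simpa using hW1 0
    · have := hsub.lim_le_div hbdd hm.ne'
      rw [le_div_iff₀ (by exact_mod_cast hm)] at this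
      exact (Real.le_logb_iff_rpow_le hb1 (hW m)).1 this
  · obtain ⟨m₁, hm₁⟩ := Filter.eventually_atTop.1
      (hlim.eventually (gt_mem_nhds (lt_add_of_pos_right _ hκ)))
    refine ⟨(b : ℝ) ^ m₁, by positivity, fun m => ?_⟩
    have hge : (1 : ℝ) ≤ (b : ℝ) ^ ((hsub.lim + κ) * m) :=
      Real.one_le_rpow hb1.le (by positivity)
    rcases le_total m m₁ with h | h
    · calc (blockCount b D m : ℝ) ≤ (b : ℝ) ^ m := by exact_mod_cast blockCount_le b hb D m
        _ ≤ (b : ℝ) ^ m₁ := pow_le_pow_right₀ hb1.le h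
        _ ≤ _ := le_mul_of_one_le_right (by positivity) hge
    · refine le_trans ?_ (le_mul_of_one_le_left (by positivity) (one_le_pow₀ hb1.le))
      rcases Nat.eq_zero_or_pos m with rfl | hm
      · have : blockCount b D 0 ≤ 1 := by simpa using blockCount_le b hb D 0
        simpa using this
      · have := hm₁ m h
        rw [div_lt_iff₀ (by exact_mod_cast hm)] at this
        exact (Real.logb_le_iff_le_rpow hb1 (hW m)).1 this.le

open Classical in
/-- A renewal-type inequality with few bad indices forces exponential growth at rate at most `t`. -/
lemma renewal_bound {ι : Type*} (T : Finset ι) (m : ι → ℕ) (M₀ : ℕ) (hm1 : ∀ a ∈ T, 1 ≤ m a)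
    (hm : ∀ a ∈ T, m a ≤ M₀) (A : ℕ → ι → ℝ) (hA : ∀ i a, 0 ≤ A i a) (F : ℕ → ℝ) (L : ℕ)
    (hF1 : ∀ i ≥ L, F i ≤ 1) (b : ℝ) (hb : 1 < b) (hFb : ∀ i < L, F i ≤ b * F (i + 1))
    (hFA : ∀ i < L, F i ≤ ∑ a ∈ T, A i a * F (i + m a)) (t : ℝ) (ht : -1 ≤ t) (η : ℝ)
    (hη : ∑ i ∈ Finset.range L, ∑ a ∈ T, A i a * b ^ (-t * m a) ≤ η * L) :
    F 0 ≤ b ^ (t * L + |t| * M₀ + 2 * (η * L)) := by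
  set Z : ℕ → ℝ := fun i => ∑ a ∈ T, A i a * b ^ (-t * m a) with hZ
  have hb0 : 0 < b := by linarith
  have hZ0 : ∀ i, 0 ≤ Z i := fun i => Finset.sum_nonneg fun a _ =>
    mul_nonneg (hA i a) (Real.rpow_nonneg hb0.le _)
  set B : ℕ → ℕ := fun i => ((Finset.Ico i L).filter fun j => 1 < Z j).card with hB
  have hBmono : ∀ i j, i ≤ j → B j ≤ B i := fun i j hij =>
    Finset.card_le_card (Finset.filter_subset_filter _ (Finset.Ico_subset_Ico_left hij))
  have key : ∀ r i : ℕ, L + M₀ = i + r →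
      F i ≤ b ^ (t * ((L : ℝ) - i) + |t| * M₀ + 2 * B i) := by
    intro r
    induction r using Nat.strong_induction_on with
    | _ r ih =>
      intro i hi
      rcases le_or_gt L i with hLi | hiL
      · refine (hF1 i hLi).trans (Real.one_le_rpow hb.le ?_)
        have h1 : |(L : ℝ) - i| ≤ M₀ := by
          have h2 : (L : ℝ) ≤ i := by exact_mod_cast hLi
          have h3 : (i : ℝ) ≤ L + M₀ := by exact_mod_cast (by omega : i ≤ L + M₀)
          rw [abs_le]; constructor <;> linarith [(Nat.cast_nonneg M₀ : (0 : ℝ) ≤ M₀)]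
        have h4 : -(|t| * M₀) ≤ t * ((L : ℝ) - i) := by
          refine le_trans (neg_le_neg ?_) (neg_abs_le _)
          rw [abs_mul]; gcongr
        have : (0 : ℝ) ≤ B i := by positivity
        linarith
      · rcases le_or_gt (Z i) 1 with hgood | hbad
        · calc F i ≤ ∑ a ∈ T, A i a * F (i + m a) := hFA i hiL
            _ ≤ ∑ a ∈ T, A i a * (b ^ (-t * m a) *
                b ^ (t * ((L : ℝ) - i) + |t| * M₀ + 2 * B i)) := by
              refine Finset.sum_le_sum fun a ha => mul_le_mul_of_nonneg_left ?_ (hA i a)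
              have h1 := hm1 a ha
              have h2 := hm a ha
              refine (ih (r - m a) (by omega) (i + m a) (by omega)).trans ?_
              rw [← Real.rpow_add hb0]
              refine Real.rpow_le_rpow_of_exponent_le hb.le ?_
              have : (B (i + m a) : ℝ) ≤ B i := by exact_mod_cast hBmono i (i + m a) (by omega)
              push_cast
              linarith
            _ = Z i * b ^ (t * ((L : ℝ) - i) + |t| * M₀ + 2 * B i) := by
              rw [hZ, Finset.sum_mul]
              exact Finset.sum_congr rfl fun a _ => by ring
            _ ≤ _ := mul_le_of_le_one_left (Real.rpow_nonneg hb0.le _) hgood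
        · have hBi : B i = B (i + 1) + 1 := by
            simp only [hB]
            rw [← Finset.insert_Ico_add_one_left_eq_Ico hiL, Finset.filter_insert, if_pos hbad,
              Finset.card_insert_of_notMem (by simp)]
          rcases Nat.eq_zero_or_pos r with h0 | hr
          · omega
          calc F i ≤ b * F (i + 1) := hFb i hiL
            _ ≤ b * b ^ (t * ((L : ℝ) - (i + 1 : ℕ)) + |t| * M₀ + 2 * B (i + 1)) := by
              gcongr
              exact ih (r - 1) (by omega) (i + 1) (by omega)
            _ = b ^ (1 + (t * ((L : ℝ) - (i + 1 : ℕ)) + |t| * M₀ + 2 * B (i + 1))) := by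
              rw [Real.rpow_add hb0 1, Real.rpow_one]
            _ ≤ _ := by
              refine Real.rpow_le_rpow_of_exponent_le hb.le ?_
              rw [hBi]; push_cast; linarith
  have hB0 : (B 0 : ℝ) ≤ η * L := by
    refine le_trans ?_ hη
    calc (B 0 : ℝ) = ((Finset.Ico 0 L).filter fun j => 1 < Z j).card • (1 : ℝ) := by simp [hB]
      _ ≤ ∑ i ∈ (Finset.Ico 0 L).filter fun j => 1 < Z j, Z i :=
        Finset.card_nsmul_le_sum _ _ _ fun i hi => (Finset.mem_filter.1 hi).2.le
      _ ≤ ∑ i ∈ Finset.range L, Z i := by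
        rw [← Finset.range_eq_Ico]
        exact Finset.sum_le_sum_of_subset_of_nonneg (Finset.filter_subset _ _)
          fun i _ _ => hZ0 i
  refine (key (L + M₀) 0 (by ring)).trans (Real.rpow_le_rpow_of_exponent_le hb.le ?_)
  simp only [Nat.cast_zero, sub_zero]
  linarith

open Polynomial Classical in
/-- If `p n + b ^ n * D` is covered modulo `1` by few arcs, then few digit blocks of `D` start at
places where the phase of `p` is close to a given one. -/
lemma ncard_digitBlock_image_le (k : ℕ) (α : ℝ) (b : ℕ) (hb : 2 ≤ b) (D h κ C : ℝ) (hh : 0 ≤ h)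
    (hκ1 : κ ≤ 1) (hW : ∀ m : ℕ, (blockCount b D m : ℝ) ≤ C * (b : ℝ) ^ ((h + κ) * m))
    (T : Finset (ℝ × ℕ)) (M₀ : ℕ) (hT1 : ∀ a ∈ T, 1 ≤ a.2) (hTM : ∀ a ∈ T, a.2 ≤ M₀)
    (p : ℝ[X]) (hp : p.natDegree ≤ k + 1) (hpα : p.coeff (k + 1) = α)
    (hcover : ∀ n : ℕ, ∃ a ∈ T, ∃ z : ℤ,
      |p.eval (n : ℝ) + (b : ℝ) ^ n * D - a.1 - z| < 1 / (b : ℝ) ^ a.2)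
    (L : ℕ)
    (hvis : ∀ a ∈ T, ∀ q : ℝ[X], q.natDegree ≤ k + 1 → q.coeff (k + 1) = α → ∀ c : ℝ,
      (((Finset.range L).filter fun i : ℕ =>
        ∃ z : ℤ, |q.eval (i : ℝ) - c - z| ≤ 3 / (b ^ a.2 : ℕ)).card : ℝ)
        ≤ 384 * L / (b ^ a.2 : ℕ))
    (S : Set ℕ) (n₀ : ℕ)
    (hclose : ∀ n ∈ S, ∀ i < L, ∃ z : ℤ,
      |p.eval ((n + i : ℕ) : ℝ) - p.eval ((n₀ + i : ℕ) : ℝ) - z| ≤ 1 / (b : ℝ) ^ M₀) :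
    (((fun n => digitBlock b D n L) '' S).ncard : ℝ)
      ≤ (b : ℝ) ^ ((h - κ) * L + |h - κ| * M₀
        + 2 * (384 * C * (∑ a ∈ T, (b : ℝ) ^ (-(1 - 2 * κ) * a.2)) * L)) := by
  have hb1 : (1 : ℝ) < b := by exact_mod_cast hb
  have hb0 : (0 : ℝ) < b := by linarith
  set R : ℕ → Finset ℤ := fun m => (finite_digitBlock b hb D m).toFinset with hR
  set P : ℕ → ℝ × ℕ → ℤ → Prop := fun i a w => ∃ z : ℤ,
    |p.eval ((n₀ + i : ℕ) : ℝ) + w / (b : ℝ) ^ a.2 - a.1 - z| ≤ 3 / (b : ℝ) ^ a.2 with hP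
  set A : ℕ → ℝ × ℕ → ℝ := fun i a => (((R a.2).filter (P i a)).card : ℝ) with hA
  set Fs : ℕ → Set ℤ := fun i => (fun n => digitBlock b D (n + i) (L - i)) '' S with hFs
  have hFsfin : ∀ i, (Fs i).Finite := fun i =>
    (finite_digitBlock b hb D (L - i)).subset (by rintro _ ⟨n, _, rfl⟩; exact ⟨n + i, rfl⟩)
  have main := renewal_bound T (fun a => a.2) M₀ hT1 hTM A (fun i a => Nat.cast_nonneg _)
    (fun i => ((Fs i).ncard : ℝ)) L ?_ b hb1 ?_ ?_ (h - κ) (by linarith)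
    (384 * C * (∑ a ∈ T, (b : ℝ) ^ (-(1 - 2 * κ) * a.2))) ?_
  · simpa [hFs] using main
  · intro i hi
    have : (Fs i).ncard ≤ ({0} : Set ℤ).ncard := by
      refine Set.ncard_le_ncard ?_ (Set.finite_singleton _)
      rintro _ ⟨n, _, rfl⟩
      simp [Nat.sub_eq_zero_of_le hi, digitBlock]
    rw [Set.ncard_singleton] at this
    exact_mod_cast this
  · intro i hi
    obtain ⟨φ, hφ⟩ := exists_digitBlock_eq b hb D (L - i) 1
    have hfin := (Set.finite_Ico (0 : ℤ) b).prod (hFsfin (i + 1))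
    have h1 : (Fs i).ncard ≤ (Set.Ico (0 : ℤ) b ×ˢ Fs (i + 1)).ncard := by
      refine le_trans (Set.ncard_le_ncard ?_ (hfin.image φ)) (Set.ncard_image_le hfin)
      rintro _ ⟨n, hn, rfl⟩
      refine ⟨(digitBlock b D (n + i) 1, digitBlock b D (n + (i + 1)) (L - (i + 1))),
        ⟨⟨digitBlock_nonneg b D (n + i) 1, ?_⟩, ⟨n, hn, rfl⟩⟩, (hφ (n + i)).symm⟩
      simpa using digitBlock_lt b hb D (n + i) 1
    rw [Set.ncard_prod, ← Finset.coe_Ico, Set.ncard_coe_finset, Int.card_Ico, sub_zero,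
      Int.toNat_natCast] at h1
    exact_mod_cast h1
  · intro i hi
    choose φ hφ using fun m => exists_digitBlock_eq b hb D (L - i) m
    have h1 : Fs i ⊆ ⋃ a ∈ T, φ a.2 ''
        ((((R a.2).filter (P i a) : Finset ℤ) : Set ℤ) ×ˢ Fs (i + a.2)) := by
      rintro _ ⟨n, hn, rfl⟩
      obtain ⟨a, ha, z, hz⟩ := hcover (n + i)
      obtain ⟨z', hz'⟩ := hclose n hn i hi
      refine Set.mem_biUnion ha ⟨(digitBlock b D (n + i) a.2, digitBlock b D (n + (i + a.2))
        (L - (i + a.2))), ⟨?_, ⟨n, hn, rfl⟩⟩, ?_⟩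
      · rw [Finset.mem_coe, Finset.mem_filter]
        refine ⟨by simp [hR], z - z' - ⌊(b : ℝ) ^ (n + i) * D⌋, ?_⟩
        have h2 := digitBlock_approx b hb D (n + i) a.2
        have h3 : 1 / (b : ℝ) ^ M₀ ≤ 1 / (b : ℝ) ^ a.2 :=
          one_div_le_one_div_of_le (by positivity) (pow_le_pow_right₀ hb1.le (hTM a ha))
        have h4 : 3 / (b : ℝ) ^ a.2
              = 1 / (b : ℝ) ^ a.2 + 1 / (b : ℝ) ^ a.2 + 1 / (b : ℝ) ^ a.2 := by
          ring
        simp only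
        rw [h4]
        push_cast at hz hz' h2 ⊢
        rw [abs_le] at hz' h2 ⊢
        rw [abs_lt] at hz
        constructor <;> linarith
      · have := hφ a.2 (n + i)
        rw [add_assoc n i, Nat.sub_sub L i] at this
        exact this.symm
    have h2 : (Fs i).ncard ≤ ∑ a ∈ T, ((R a.2).filter (P i a)).card * (Fs (i + a.2)).ncard := by
      refine (Set.ncard_le_ncard h1 ?_).trans ((Finset.set_ncard_biUnion_le _ _).trans
        (Finset.sum_le_sum fun a _ => ?_))
      · exact T.finite_toSet.biUnion fun a _ =>
          ((Finset.finite_toSet _).prod (hFsfin _)).image _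
      · refine (Set.ncard_image_le ((Finset.finite_toSet _).prod (hFsfin _))).trans ?_
        rw [Set.ncard_prod, Set.ncard_coe_finset]
    simp only [hA]
    exact_mod_cast h2
  · rw [Finset.sum_comm, Finset.mul_sum, Finset.sum_mul]
    refine Finset.sum_le_sum fun a ha => ?_
    rw [← Finset.sum_mul]
    have hM : ((b ^ a.2 : ℕ) : ℝ) = (b : ℝ) ^ (a.2 : ℝ) := by push_cast; rw [Real.rpow_natCast]
    have hsum : ∑ i ∈ Finset.range L, A i a
        ≤ blockCount b D a.2 * (384 * L / (b ^ a.2 : ℕ)) := by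
      have h1 : ∑ i ∈ Finset.range L, A i a
          = ∑ w ∈ R a.2, (((Finset.range L).filter fun i => P i a w).card : ℝ) := by
        simp only [hA, Finset.card_filter]
        push_cast
        exact Finset.sum_comm
      have h2 : (blockCount b D a.2 : ℝ) = (R a.2).card := by
        rw [blockCount, Set.ncard_eq_toFinset_card _ (finite_digitBlock b hb D a.2)]
      rw [h1, h2, ← nsmul_eq_mul]
      refine Finset.sum_le_card_nsmul _ _ _ fun w _ => ?_
      have h3 := hvis a ha (taylor (n₀ : ℝ) p) (by rw [natDegree_taylor]; exact hp) ?_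
        (a.1 - w / (b : ℝ) ^ a.2)
      · refine le_trans (le_of_eq ?_) h3
        congr 2
        refine Finset.filter_congr fun i _ => exists_congr fun z => ?_
        rw [taylor_eval]
        push_cast
        rw [show eval ((n₀ : ℝ) + i) p + w / (b : ℝ) ^ a.2 - a.1 - z
          = eval ((i : ℝ) + n₀) p - (a.1 - w / (b : ℝ) ^ a.2) - z by rw [add_comm (n₀ : ℝ)]; ring]
      · rw [coeff_taylor_of_natDegree_le hp, hpα]
    have hrp : (0 : ℝ) ≤ (b : ℝ) ^ (-(h - κ) * a.2) := Real.rpow_nonneg hb0.le _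
    calc _ ≤ (C * (b : ℝ) ^ ((h + κ) * a.2) * (384 * L / (b ^ a.2 : ℕ)))
            * (b : ℝ) ^ (-(h - κ) * a.2) := by
          refine mul_le_mul_of_nonneg_right (hsum.trans ?_) hrp
          exact mul_le_mul_of_nonneg_right (hW _) (by positivity)
      _ = 384 * C * L * ((b : ℝ) ^ ((h + κ) * a.2) * (b : ℝ) ^ (-(a.2 : ℝ))
            * (b : ℝ) ^ (-(h - κ) * a.2)) := by
          rw [hM, Real.rpow_neg hb0.le]; ring
      _ = _ := by
          rw [← Real.rpow_add hb0, ← Real.rpow_add hb0,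
            show (h + κ) * (a.2 : ℝ) + -(a.2 : ℝ) + -(h - κ) * a.2 = -(1 - 2 * κ) * a.2 by ring]
          ring

open Polynomial in
/-- The phases `i ↦ p (n + i)` modulo `1` on a window of length `L` fall, up to precision `ρ`, into
a number of classes growing only polynomially in `L`. -/
lemma exists_phase_cells (k : ℕ) (p : ℝ[X]) (hp : p.natDegree ≤ k + 1) (ρ : ℝ) (hρ : 0 < ρ) :
    ∃ K : ℕ, ∀ L : ℕ, 1 ≤ L → ∃ (G : Finset (Fin (k + 2) → ℤ)) (g : ℕ → Fin (k + 2) → ℤ),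
      G.card ≤ (K * L ^ (k + 1)) ^ (k + 2) ∧ (∀ n, g n ∈ G) ∧
      ∀ n n', g n = g n' → ∀ i < L, ∃ z : ℤ,
        |p.eval ((n + i : ℕ) : ℝ) - p.eval ((n' + i : ℕ) : ℝ) - z| ≤ ρ := by
  obtain ⟨K, hK⟩ := exists_nat_ge ((k + 2 : ℕ) / ρ)
  have hK0 : 0 < K := by
    have : (0 : ℝ) < K := lt_of_lt_of_le (by positivity) hK
    exact_mod_cast this
  refine ⟨K, fun L hL => ?_⟩
  set Q : ℕ := K * L ^ (k + 1) with hQ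
  have hQ0 : 0 < Q := by positivity
  have hQ0' : (0 : ℝ) < Q := by exact_mod_cast hQ0
  refine ⟨Fintype.piFinset fun _ => Finset.Ico 0 (Q : ℤ),
    fun n l => ⌊Int.fract ((taylor (n : ℝ) p).coeff l) * Q⌋, ?_, ?_, ?_⟩
  · simp
  · intro n
    rw [Fintype.mem_piFinset]
    intro l
    rw [Finset.mem_Ico]
    refine ⟨Int.floor_nonneg.2 (mul_nonneg (Int.fract_nonneg _) hQ0'.le), Int.floor_lt.2 ?_⟩
    have := Int.fract_lt_one ((taylor (n : ℝ) p).coeff l)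
    push_cast
    nlinarith
  · intro n n' hnn i hi
    have hexp : ∀ n : ℕ, p.eval ((n + i : ℕ) : ℝ)
        = ∑ l : Fin (k + 2), (taylor (n : ℝ) p).coeff l * (i : ℝ) ^ (l : ℕ) := by
      intro n
      rw [Nat.cast_add, add_comm, ← taylor_eval,
        eval_eq_sum_range' (n := k + 2) (by rw [natDegree_taylor]; omega), Finset.sum_range]
    refine ⟨∑ l : Fin (k + 2), (⌊(taylor (n : ℝ) p).coeff l⌋ - ⌊(taylor (n' : ℝ) p).coeff l⌋)
      * (i : ℤ) ^ (l : ℕ), ?_⟩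
    rw [hexp, hexp]
    push_cast
    rw [← Finset.sum_sub_distrib, ← Finset.sum_sub_distrib]
    calc _ ≤ ∑ l : Fin (k + 2), (1 / Q * (L : ℝ) ^ (k + 1) : ℝ) := by
          refine (Finset.abs_sum_le_sum_abs _ _).trans (Finset.sum_le_sum fun l _ => ?_)
          rw [show (taylor (n : ℝ) p).coeff l * (i : ℝ) ^ (l : ℕ)
              - (taylor (n' : ℝ) p).coeff l * (i : ℝ) ^ (l : ℕ)
              - (⌊(taylor (n : ℝ) p).coeff l⌋ - ⌊(taylor (n' : ℝ) p).coeff l⌋) * (i : ℝ) ^ (l : ℕ)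
              = (Int.fract ((taylor (n : ℝ) p).coeff l) - Int.fract ((taylor (n' : ℝ) p).coeff l))
                * (i : ℝ) ^ (l : ℕ) by simp only [Int.fract]; ring, abs_mul]
          have h1 := Int.abs_sub_lt_one_of_floor_eq_floor (congrFun hnn l)
          rw [← sub_mul, abs_mul, abs_of_pos hQ0', ← lt_div_iff₀ hQ0'] at h1
          have hL1 : (1 : ℝ) ≤ L := by exact_mod_cast hL
          refine mul_le_mul h1.le ?_ (abs_nonneg _) (by positivity)
          rw [abs_of_nonneg (by positivity)]
          calc (i : ℝ) ^ (l : ℕ) ≤ (L : ℝ) ^ (l : ℕ) := by gcongr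
            _ ≤ _ := pow_le_pow_right₀ hL1 (by omega)
      _ = (k + 2 : ℕ) / K := by
          have : (L : ℝ) ≠ 0 := by positivity
          simp only [Finset.sum_const, Finset.card_univ, Fintype.card_fin, nsmul_eq_mul, hQ]
          push_cast
          field_simp
      _ ≤ ρ := by
          rw [div_le_iff₀ hρ] at hK
          rw [div_le_iff₀ (by positivity)]; linarith

open Polynomial in
/-- The values `p n + b ^ n * D` modulo `1` have no coverings of small `s`-dimensional content. -/
theorem not_forall_exists_small_cover (k : ℕ) (p : ℝ[X]) (hp : p.natDegree ≤ k + 1)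
    (hpα : Irrational (p.coeff (k + 1))) (b : ℕ) (hb : 2 ≤ b) (D s : ℝ) (hs0 : 0 ≤ s)
    (hs1 : s < 1)
    (hsmall : ∀ ε : ℝ, 0 < ε → ∃ T : Finset (ℝ × ℕ), (∀ a ∈ T, 1 ≤ a.2) ∧
      (∑ a ∈ T, (b : ℝ) ^ (-s * a.2) ≤ ε) ∧
      ∀ n : ℕ, ∃ a ∈ T, ∃ z : ℤ,
        |p.eval (n : ℝ) + (b : ℝ) ^ n * D - a.1 - z| < 1 / (b : ℝ) ^ a.2) : False := by
  have hb1 : (1 : ℝ) < b := by exact_mod_cast hb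
  have hb0 : (0 : ℝ) < b := by linarith
  set κ : ℝ := (1 - s) / 2 with hκ
  have hκ0 : 0 < κ := by rw [hκ]; linarith
  obtain ⟨h, hh, hlow, C, hC, hup⟩ := exists_blockCount_rate b hb D κ hκ0
  obtain ⟨T, hT1, hTs, hcover⟩ := hsmall (κ / 4 / (384 * C)) (by positivity)
  set M₀ : ℕ := T.sup fun a => a.2 with hM₀
  have hTM : ∀ a ∈ T, a.2 ≤ M₀ := fun a ha => Finset.le_sup (f := fun a : ℝ × ℕ => a.2) ha
  choose L₁ hL₁ using fun a : ℝ × ℕ => card_visits_le k _ hpα (b ^ a.2) (by positivity)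
  obtain ⟨K, hK⟩ := exists_phase_cells k p hp (1 / (b : ℝ) ^ M₀) (by positivity)
  have hmain : ∀ L : ℕ, 1 ≤ L → T.sup L₁ ≤ L →
      1 ≤ (K : ℝ) ^ (k + 2) * (b : ℝ) ^ (|h - κ| * M₀)
        * ((L : ℝ) ^ ((k + 1) * (k + 2)) * ((b : ℝ) ^ (-(κ / 2))) ^ L) := by
    intro L hL1 hL
    obtain ⟨G, g, hGcard, hgG, hg⟩ := hK L hL1
    set E : ℝ := (b : ℝ) ^ ((h - κ) * L + |h - κ| * M₀ + κ / 2 * L) with hE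
    have hcell : ∀ γ ∈ G, (((fun n => digitBlock b D n L) '' {n | g n = γ}).ncard : ℝ) ≤ E := by
      intro γ _
      rcases Set.eq_empty_or_nonempty {n | g n = γ} with he | ⟨n₀, hn₀⟩
      · rw [he]; simp only [Set.image_empty, Set.ncard_empty, Nat.cast_zero]
        exact Real.rpow_nonneg hb0.le _
      · refine (ncard_digitBlock_image_le k _ b hb D h κ C hh (by rw [hκ]; linarith) hup T M₀ hT1
          hTM p hp rfl hcover L (fun a ha q hq hqα c => ?_) _ n₀ (fun n hn i hi => ?_)).trans ?_
        · exact hL₁ a L ((Finset.le_sup ha).trans hL) q hq hqα c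
        · exact hg n n₀ (by rw [hn, hn₀]) i hi
        · refine Real.rpow_le_rpow_of_exponent_le hb1.le ?_
          rw [show -(1 - 2 * κ) = -s by rw [hκ]; ring]
          have h1 : 384 * C * (∑ a ∈ T, (b : ℝ) ^ (-s * a.2)) ≤ κ / 4 := by
            rw [le_div_iff₀ (by positivity)] at hTs; linarith
          have h2 : 384 * C * (∑ a ∈ T, (b : ℝ) ^ (-s * a.2)) * L ≤ κ / 4 * L := by gcongr
          linarith
    have hcount : (blockCount b D L : ℝ) ≤ G.card * E := by
      have h1 : (Set.range fun n => digitBlock b D n L)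
          = ⋃ γ ∈ G, (fun n => digitBlock b D n L) '' {n | g n = γ} := by
        ext w
        simp only [Set.mem_range, Set.mem_iUnion, Set.mem_image, Set.mem_ofPred_eq]
        constructor
        · rintro ⟨n, rfl⟩
          exact ⟨g n, hgG n, n, rfl, rfl⟩
        · rintro ⟨_, _, n, _, rfl⟩
          exact ⟨n, rfl⟩
      have h2 : blockCount b D L
          ≤ ∑ γ ∈ G, ((fun n => digitBlock b D n L) '' {n | g n = γ}).ncard := by
        rw [blockCount, h1]
        exact Finset.set_ncard_biUnion_le _ _
      have h3 : (blockCount b D L : ℝ)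
          ≤ ∑ γ ∈ G, (((fun n => digitBlock b D n L) '' {n | g n = γ}).ncard : ℝ) := by
        exact_mod_cast h2
      rw [← nsmul_eq_mul]
      exact h3.trans (Finset.sum_le_card_nsmul _ _ _ hcell)
    have hG' : (G.card : ℝ) ≤ (K : ℝ) ^ (k + 2) * (L : ℝ) ^ ((k + 1) * (k + 2)) := by
      rw [pow_mul, ← mul_pow]; exact_mod_cast hGcard
    have h5 : (b : ℝ) ^ (h * L) ≤ (K : ℝ) ^ (k + 2) * (L : ℝ) ^ ((k + 1) * (k + 2)) * E :=
      (hlow L).trans (hcount.trans (mul_le_mul_of_nonneg_right hG' (Real.rpow_nonneg hb0.le _)))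
    have h6 : E = (b : ℝ) ^ (h * L) * ((b : ℝ) ^ (|h - κ| * M₀) * ((b : ℝ) ^ (-(κ / 2))) ^ L) := by
      rw [hE, ← Real.rpow_mul_natCast hb0.le, ← Real.rpow_add hb0, ← Real.rpow_add hb0]
      congr 1; ring
    have h7 : 0 < (b : ℝ) ^ (h * L) := Real.rpow_pos_of_pos hb0 _
    refine le_of_mul_le_mul_left ?_ h7
    rw [h6] at h5
    linarith
  have hr : |(b : ℝ) ^ (-(κ / 2))| < 1 := by
    rw [abs_of_nonneg (Real.rpow_nonneg hb0.le _)]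
    exact Real.rpow_lt_one_of_one_lt_of_neg hb1 (by linarith)
  have hlim := (tendsto_pow_const_mul_const_pow_of_abs_lt_one ((k + 1) * (k + 2)) hr).const_mul
    ((K : ℝ) ^ (k + 2) * (b : ℝ) ^ (|h - κ| * M₀))
  rw [mul_zero] at hlim
  obtain ⟨L, hL, hL1, hL2⟩ := ((hlim.eventually (gt_mem_nhds one_pos)).and
    ((Filter.eventually_ge_atTop 1).and (Filter.eventually_ge_atTop (T.sup L₁)))).exists
  exact absurd (hmain L hL1 hL2) (not_le.2 hL)

lemma exists_scale (b : ℕ) (hb : 2 ≤ b) (s : ℝ) (hs : 0 < s) (δ : ℝ) (hδ : 0 ≤ δ)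
    (hδb : δ ≤ 1 / (2 * b)) (τ : ℝ) (hτ : 0 < τ) :
    ∃ m : ℕ, 1 ≤ m ∧ δ < 1 / (b : ℝ) ^ m ∧ (b : ℝ) ^ (-s * m) ≤ (2 * b : ℝ) ^ s * δ ^ s + τ := by
  have hb1 : (1 : ℝ) < b := by exact_mod_cast hb
  have hb0 : (0 : ℝ) < b := by linarith
  have hinv : (b : ℝ)⁻¹ < 1 := inv_lt_one_of_one_lt₀ hb1
  have hpow : ∀ m : ℕ, (b : ℝ) ^ (-s * m) = (1 / (b : ℝ) ^ m) ^ s := by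
    intro m
    rw [Real.div_rpow zero_le_one (by positivity), Real.one_rpow, ← Real.rpow_natCast_mul hb0.le,
      neg_mul, Real.rpow_neg hb0.le, one_div, mul_comm]
  rcases hδ.eq_or_lt with rfl | hpos
  · have hlim : Filter.Tendsto (fun m : ℕ => ((b : ℝ) ^ (-s)) ^ m) Filter.atTop (nhds 0) :=
      tendsto_pow_atTop_nhds_zero_of_lt_one (Real.rpow_nonneg hb0.le _)
        (Real.rpow_lt_one_of_one_lt_of_neg hb1 (by linarith))
    obtain ⟨m, hm, hm1⟩ := ((hlim.eventually (gt_mem_nhds hτ)).and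
      (Filter.eventually_ge_atTop 1)).exists
    refine ⟨m, hm1, by positivity, ?_⟩
    rw [Real.zero_rpow hs.ne', mul_zero, zero_add, Real.rpow_mul_natCast hb0.le]
    exact hm.le
  · have h2 : 2 * δ ≤ (b : ℝ)⁻¹ := by
      calc 2 * δ ≤ 2 * (1 / (2 * b)) := by gcongr
        _ = _ := by field_simp
    obtain ⟨m, hm1, hm2⟩ := exists_nat_pow_near_of_lt_one (x := 2 * δ) (by positivity)
      (h2.trans hinv.le) (inv_pos.2 hb0) hinv
    refine ⟨m, ?_, ?_, ?_⟩
    · by_contra h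
      have : m = 0 := by omega
      subst this
      simp only [zero_add, pow_one] at hm1
      linarith
    · rw [one_div, ← inv_pow]; linarith
    · rw [hpow, ← Real.mul_rpow (by positivity) hδ]
      refine le_add_of_le_of_nonneg (Real.rpow_le_rpow (by positivity) ?_ hs.le) hτ.le
      rw [one_div, ← inv_pow]
      calc ((b : ℝ)⁻¹) ^ m = b * ((b : ℝ)⁻¹) ^ (m + 1) := by rw [pow_succ]; field_simp
        _ ≤ b * (2 * δ) := by gcongr
        _ = _ := by ring

/-- A compact set of zero Hausdorff measure has finite coverings by `b`-adically sized intervals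
of small total content. -/
lemma IsCompact.exists_small_cover {X : Set ℝ} (hX : IsCompact X) (s : ℝ) (hs : 0 < s)
    (hμ : μH[s] X = 0) (b : ℕ) (hb : 2 ≤ b) (ε : ℝ) (hε : 0 < ε) :
    ∃ T : Finset (ℝ × ℕ), (∀ a ∈ T, 1 ≤ a.2) ∧ (∑ a ∈ T, (b : ℝ) ^ (-s * a.2) ≤ ε) ∧
      ∀ x ∈ X, ∃ a ∈ T, |x - a.1| < 1 / (b : ℝ) ^ a.2 := by
  classical
  have hb0 : (0 : ℝ) < b := by positivity
  set c : ℝ := (2 * b : ℝ) ^ s with hc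
  have hc0 : 0 < c := Real.rpow_pos_of_pos (by positivity) _
  rw [Measure.hausdorffMeasure_apply] at hμ
  have h0 := ENNReal.iSup_eq_zero.1 (ENNReal.iSup_eq_zero.1 hμ (ENNReal.ofReal (1 / (2 * b))))
    (ENNReal.ofReal_pos.2 (by positivity))
  have h1 : _ < ENNReal.ofReal (ε / 2 / c) := h0.trans_lt (ENNReal.ofReal_pos.2 (by positivity))
  simp only [iInf_lt_iff] at h1
  obtain ⟨t, htX, htr, hts⟩ := h1
  have hfin : ∀ n, Metric.ediam (t n) ≠ ⊤ := fun n =>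
    ((htr n).trans_lt ENNReal.ofReal_lt_top).ne
  have hex : ∀ n, ∃ q : ℝ × ℕ, 1 ≤ q.2 ∧ t n ⊆ Metric.ball q.1 (1 / (b : ℝ) ^ q.2) ∧
      (b : ℝ) ^ (-s * q.2) ≤ c * Metric.diam (t n) ^ s + ε / 2 / 2 * (1 / 2) ^ n := by
    intro n
    obtain ⟨m, hm1, hm2, hm3⟩ := exists_scale b hb s hs (Metric.diam (t n)) Metric.diam_nonneg
      (ENNReal.toReal_le_of_le_ofReal (by positivity) (htr n)) (ε / 2 / 2 * (1 / 2) ^ n)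
      (by positivity)
    rcases (t n).eq_empty_or_nonempty with he | ⟨y, hy⟩
    · exact ⟨(0, m), hm1, by simp [he], hm3⟩
    · refine ⟨(y, m), hm1, fun x hx => ?_, hm3⟩
      exact (Metric.dist_le_diam_of_mem' (hfin n) hx hy).trans_lt hm2
  choose q hq1 hqt hqs using hex
  obtain ⟨J, hJ⟩ := hX.elim_finite_subcover (fun n => Metric.ball (q n).1 (1 / (b : ℝ) ^ (q n).2))
    (fun n => Metric.isOpen_ball) (htX.trans (Set.iUnion_mono hqt))
  refine ⟨J.image q, ?_, ?_, ?_⟩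
  · intro a ha
    obtain ⟨n, _, rfl⟩ := Finset.mem_image.1 ha
    exact hq1 n
  · have hdiam : ∑ n ∈ J, Metric.diam (t n) ^ s ≤ ε / 2 / c := by
      have : ENNReal.ofReal (∑ n ∈ J, Metric.diam (t n) ^ s) ≤ ENNReal.ofReal (ε / 2 / c) := by
        rw [ENNReal.ofReal_sum_of_nonneg fun n _ => Real.rpow_nonneg Metric.diam_nonneg _]
        refine le_trans ?_ ((ENNReal.sum_le_tsum J).trans hts.le)
        refine Finset.sum_le_sum fun n _ => ?_
        rw [← ENNReal.ofReal_rpow_of_nonneg Metric.diam_nonneg hs.le, Metric.diam,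
          ENNReal.ofReal_toReal (hfin n)]
        rcases (t n).eq_empty_or_nonempty with he | hne
        · simp [he, hs]
        · exact le_iSup (fun _ : (t n).Nonempty => Metric.ediam (t n) ^ s) hne
      exact (ENNReal.ofReal_le_ofReal_iff (by positivity)).1 this
    have hgeo : ∑ n ∈ J, ε / 2 / 2 * (1 / 2 : ℝ) ^ n ≤ ε / 2 := by
      have := summable_geometric_two.sum_le_tsum J (fun n _ => by positivity)
      rw [tsum_geometric_two] at this
      rw [← Finset.mul_sum]
      calc _ ≤ ε / 2 / 2 * 2 := by gcongr
        _ = _ := by ring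
    calc ∑ a ∈ J.image q, (b : ℝ) ^ (-s * a.2) ≤ ∑ n ∈ J, (b : ℝ) ^ (-s * (q n).2) :=
          Finset.sum_image_le_of_nonneg (fun _ _ => Real.rpow_nonneg hb0.le _)
      _ ≤ ∑ n ∈ J, (c * Metric.diam (t n) ^ s + ε / 2 / 2 * (1 / 2) ^ n) :=
          Finset.sum_le_sum fun n _ => hqs n
      _ ≤ c * (ε / 2 / c) + ε / 2 := by
          rw [Finset.sum_add_distrib, ← Finset.mul_sum]
          gcongr
      _ = ε := by field_simp; ring
  · intro x hx
    obtain ⟨n, hn, hxn⟩ := Set.mem_iUnion₂.1 (hJ hx)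
    exact ⟨q n, Finset.mem_image_of_mem q hn, hxn⟩

/-- Finitely many rational numbers have a common denominator. -/
lemma exists_common_denominator (a : ℕ → ℝ) (J : Finset ℕ) (hJ : ∀ j ∈ J, ¬ Irrational (a j)) :
    ∃ q : ℕ, 1 ≤ q ∧ ∀ j ∈ J, ∃ w : ℤ, a j * q = w := by
  have : ∀ j, ∃ r : ℚ, j ∈ J → a j = r := by
    intro j
    by_cases hj : j ∈ J
    · have := hJ j hj
      rw [Irrational, not_not] at this
      obtain ⟨r, hr⟩ := this
      exact ⟨r, fun _ => hr.symm⟩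
    · exact ⟨0, fun h => absurd h hj⟩
  choose r hr using this
  refine ⟨∏ j ∈ J, (r j).den, Finset.prod_pos fun j _ => (r j).den_pos, fun j hj => ?_⟩
  obtain ⟨e, he⟩ := Finset.dvd_prod_of_mem (fun j => (r j).den) hj
  refine ⟨(r j).num * e, ?_⟩
  rw [he, hr j hj]
  push_cast
  rw [← mul_assoc]
  congr 1
  exact_mod_cast Rat.mul_den_eq_num (r j)

/-- Let `p(n) = ∑_{i=0}^k a_i n^i` have at least one irrational coefficient
among the non-constant terms, and let `d` be any real. Then the closure of
`{frac (p(n) + 2^n d) : n ≥ 1}` has Hausdorff dimension `1`. -/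
theorem dimH_closure_fract_poly_plus_doubling (k : ℕ) (a : ℕ → ℝ)
    (hirr : ∃ i, 1 ≤ i ∧ i ≤ k ∧ Irrational (a i)) (d : ℝ) :
    dimH (closure {x : ℝ | ∃ n : ℕ, 1 ≤ n ∧
      x = Int.fract ((∑ i ∈ Finset.range (k + 1), a i * (n : ℝ) ^ i) + 2 ^ n * d)}) = 1 := by
  classical
  set Y : Set ℝ := {x : ℝ | ∃ n : ℕ, 1 ≤ n ∧
      x = Int.fract ((∑ i ∈ Finset.range (k + 1), a i * (n : ℝ) ^ i) + 2 ^ n * d)} with hY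
  refine le_antisymm ((dimH_mono (Set.subset_univ _)).trans Real.dimH_univ.le) ?_
  by_contra hlt
  rw [not_le] at hlt
  obtain ⟨s, hs, hs1⟩ := ENNReal.lt_iff_exists_nnreal_btwn.1 hlt
  have hs0 : (0 : ℝ) < s := by
    have : (0 : ENNReal) < s := zero_le.trans_lt hs
    exact_mod_cast this
  have hs1' : (s : ℝ) < 1 := by exact_mod_cast hs1
  have hμ : μH[(s : ℝ)] (closure Y) = 0 := hausdorffMeasure_of_dimH_lt hs
  have hcomp : IsCompact (closure Y) := by
    refine (isCompact_Icc (a := (0 : ℝ)) (b := 1)).of_isClosed_subset isClosed_closure ?_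
    refine closure_minimal ?_ isClosed_Icc
    rintro _ ⟨n, _, rfl⟩
    exact ⟨Int.fract_nonneg _, (Int.fract_lt_one _).le⟩
  set I : Finset ℕ := (Finset.Icc 1 k).filter fun i => Irrational (a i) with hI
  have hIne : I.Nonempty := by
    obtain ⟨i, h1, h2, h3⟩ := hirr
    exact ⟨i, by simp [hI, h1, h2, h3]⟩
  obtain ⟨i₀, hi₀, hmax⟩ := I.exists_max_image id hIne
  simp only [hI, Finset.mem_filter, Finset.mem_Icc, id] at hi₀ hmax
  obtain ⟨⟨hi1, hik⟩, hirr₀⟩ := hi₀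
  obtain ⟨q, hq1, hq⟩ := exists_common_denominator a (Finset.Ico (i₀ + 1) (k + 1)) (by
    intro j hj h
    rw [Finset.mem_Ico] at hj
    have := hmax j ⟨⟨by omega, by omega⟩, h⟩
    omega)
  obtain ⟨e, rfl⟩ : ∃ e, i₀ = e + 1 := ⟨i₀ - 1, by omega⟩
  set P : Polynomial ℝ := ∑ j ∈ Finset.range (e + 2),
    Polynomial.C (a j * (q : ℝ) ^ j) * Polynomial.X ^ j with hP
  have hPdeg : P.natDegree ≤ e + 1 := by
    refine Polynomial.natDegree_sum_le_of_forall_le _ _ fun j hj => ?_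
    refine (Polynomial.natDegree_C_mul_X_pow_le _ _).trans ?_
    rw [Finset.mem_range] at hj; omega
  have hPcoeff : P.coeff (e + 1) = a (e + 1) * ((q ^ (e + 1) : ℕ) : ℝ) := by
    simp only [hP, Polynomial.finsetSum_coeff, Polynomial.coeff_C_mul, Polynomial.coeff_X_pow]
    simp
  refine not_forall_exists_small_cover e (Polynomial.taylor 1 P)
    (by rw [Polynomial.natDegree_taylor]; exact hPdeg) ?_ (2 ^ q)
    (by simpa using Nat.pow_le_pow_right (n := 2) two_pos hq1) (2 ^ q * d) s hs0.le hs1' ?_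
  · rw [Polynomial.coeff_taylor_of_natDegree_le hPdeg, hPcoeff]
    exact hirr₀.mul_natCast (by positivity)
  · intro ε hε
    obtain ⟨T, hT1, hTs, hT⟩ := hcomp.exists_small_cover s hs0 hμ (2 ^ q)
      (by simpa using Nat.pow_le_pow_right (n := 2) two_pos hq1) ε hε
    refine ⟨T, hT1, hTs, fun n => ?_⟩
    set N : ℕ := q * (n + 1) with hN
    set V : ℝ := (∑ i ∈ Finset.range (k + 1), a i * (N : ℝ) ^ i) + 2 ^ N * d with hV
    obtain ⟨c, hc, hcV⟩ := hT (Int.fract V) (subset_closure ⟨N, Nat.mul_pos hq1 n.succ_pos, rfl⟩)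
    have htail : ∃ w : ℤ, ∑ j ∈ Finset.Ico (e + 2) (k + 1), a j * (N : ℝ) ^ j = w := by
      have : ∀ j, ∃ w : ℤ, j ∈ Finset.Ico (e + 2) (k + 1) → a j * (N : ℝ) ^ j = w := by
        intro j
        by_cases hj : j ∈ Finset.Ico (e + 2) (k + 1)
        · obtain ⟨w, hw⟩ := hq j hj
          obtain ⟨j', rfl⟩ : ∃ j', j = j' + 1 := ⟨j - 1, by rw [Finset.mem_Ico] at hj; omega⟩
          refine ⟨w * (n + 1) * (N : ℤ) ^ j', fun _ => ?_⟩
          push_cast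
          rw [← hw, hN]; push_cast; ring
        · exact ⟨0, fun h => absurd h hj⟩
      choose w hw using this
      exact ⟨∑ j ∈ Finset.Ico (e + 2) (k + 1), w j, by push_cast; exact Finset.sum_congr rfl hw⟩
    obtain ⟨w, hw⟩ := htail
    have heval : (Polynomial.taylor 1 P).eval (n : ℝ)
        = ∑ j ∈ Finset.range (e + 2), a j * (N : ℝ) ^ j := by
      rw [Polynomial.taylor_eval, hP, Polynomial.eval_finsetSum]
      refine Finset.sum_congr rfl fun j _ => ?_
      simp only [Polynomial.eval_mul, Polynomial.eval_C, Polynomial.eval_pow, Polynomial.eval_X, hN]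
      push_cast
      rw [mul_pow]; ring
    have hpow : ((2 ^ q : ℕ) : ℝ) ^ n * (2 ^ q * d) = 2 ^ N * d := by
      rw [hN]; push_cast; ring
    refine ⟨c, hc, ⌊V⌋ - w, ?_⟩
    rw [heval, hpow]
    rw [← Finset.sum_range_add_sum_Ico _ (by omega : e + 2 ≤ k + 1), hw] at hV
    rw [Int.fract] at hcV
    convert hcV using 2
    rw [hV]; push_cast; ring
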